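/- Let q be a prime, G a commutative group of order q, and h, h₁ ∈ G. Suppose ĉ_N, t₂ ∈ G, u ∈ (ZMod q)^N, and c, c*, s₂, s₂* ∈ ZMod q satisfy c ≠ c*, t₂ = (ĉ_N / h₁^{∏_{i=1}^N u_i})^{-c} h^{s₂} and t₂ = (ĉ_N / h₁^{∏_{i=1}^N u_i})^{-c*} h^{s₂*}. Then ĉ_N = h^{r⋄} h₁^{∏_{i=1}^N u_i} where r⋄ = (s₂-s₂*)/(c-c*); that is, ĉ_N = PC_{h,h₁}(∏_{i=1}^N u_i, r⋄). -/

import Mathlib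

/-- Exponentiation of a monoid element by an element of `ZMod n`. -/
instance (priority := low) monoidZModPow {M : Type*} [Monoid M] {n : ℕ} :
    Pow M (ZMod n) := ⟨fun g x => g ^ x.val⟩

/-- The Pedersen commitment with bases `h` and `h₁`: `PC(m, r) = h^r h₁^m`. -/
def PC {G : Type*} [CommGroup G] {q : ℕ} (h h₁ : G) (m r : ZMod q) : G :=
  h ^ r * h₁ ^ m

theorem pow_zmod_def {M : Type*} [Monoid M] {n : ℕ} (g : M) (x : ZMod n) :
    g ^ x = g ^ x.val := rfl

theorem pow_zmod_add {M : Type*} [Monoid M] {n : ℕ} [NeZero n] {g : M} (hg : g ^ n = 1)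
    (x y : ZMod n) : g ^ (x + y) = g ^ x * g ^ y := by
  rw [pow_zmod_def, pow_zmod_def, pow_zmod_def, ZMod.val_add, ← pow_add]
  exact (pow_eq_pow_mod _ hg).symm

theorem pow_zmod_mul {M : Type*} [Monoid M] {n : ℕ} {g : M} (hg : g ^ n = 1)
    (x y : ZMod n) : g ^ (x * y) = (g ^ x) ^ y := by
  rw [pow_zmod_def, pow_zmod_def, pow_zmod_def, ZMod.val_mul, ← pow_mul]
  exact (pow_eq_pow_mod _ hg).symm

theorem pow_zmod_zero {M : Type*} [Monoid M] {n : ℕ} (g : M) :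
    g ^ (0 : ZMod n) = 1 := by
  rw [pow_zmod_def, ZMod.val_zero, pow_zero]

theorem pow_zmod_one {M : Type*} [Monoid M] {n : ℕ} [Fact (1 < n)] (g : M) :
    g ^ (1 : ZMod n) = g := by
  rw [pow_zmod_def, ZMod.val_one, pow_one]

/-- Two accepting transcripts with distinct challenges determine a discrete logarithm. -/
theorem eq_pow_div_of_transcripts {q : ℕ} [Fact (Nat.Prime q)] {G : Type*} [CommGroup G]
    {a h : G} (ha : a ^ q = 1) (hh : h ^ q = 1) {c d s t : ZMod q} (hne : c ≠ d)
    (heq : a ^ (-c) * h ^ s = a ^ (-d) * h ^ t) : a = h ^ ((s - t) / (c - d)) := by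
  have key : a ^ (c - d) = h ^ (s - t) :=
    calc a ^ (c - d) = a ^ c * (a ^ (-d) * h ^ t) * h ^ (-t) := by
          rw [sub_eq_add_neg, pow_zmod_add ha, mul_assoc, mul_assoc, ← pow_zmod_add hh,
            add_neg_cancel, pow_zmod_zero, mul_one]
      _ = h ^ (s - t) := by
          rw [← heq, ← mul_assoc, ← pow_zmod_add ha, add_neg_cancel, pow_zmod_zero, one_mul,
            ← pow_zmod_add hh, sub_eq_add_neg]
  rw [div_eq_mul_inv, pow_zmod_mul hh, ← key, ← pow_zmod_mul ha,
    mul_inv_cancel₀ (sub_ne_zero.mpr hne), pow_zmod_one]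

theorem stmt_11 {q : ℕ} [Fact (Nat.Prime q)] {G : Type*} [CommGroup G] [Fintype G]
    (hcard : Fintype.card G = q) (h h₁ : G) {N : ℕ}
    (chatN t₂ : G) (u : Fin N → ZMod q) (c cstar s₂ s₂star : ZMod q)
    (hne : c ≠ cstar)
    (h1 : t₂ = (chatN / h₁ ^ (∏ i, u i)) ^ (-c) * h ^ s₂)
    (h2 : t₂ = (chatN / h₁ ^ (∏ i, u i)) ^ (-cstar) * h ^ s₂star) :
    chatN = PC h h₁ (∏ i, u i) ((s₂ - s₂star) / (c - cstar)) := by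
  have hpow (g : G) : g ^ q = 1 := hcard ▸ pow_card_eq_one
  exact div_eq_iff_eq_mul.mp
    (eq_pow_div_of_transcripts (hpow _) (hpow h) hne (h1.symm.trans h2))
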